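/- arXiv:1502.04148 — 5 statements merged into one kernel-verified Lean document; each statement's English description precedes it below -/
import Mathlib

section
/- Let A be an n×m complex matrix, let Σ be an n×n Hermitian positive semidefinite matrix, let R = A Aᴴ + Σ, and let P be a Moore–Penrose pseudoinverse of R. Fix k ∈ {1,…,m}, let A_k denote the k-th column of A, and let b₀ = A_kᴴ P (a 1×n row vector). Then for every row vector b ∈ ℂ^{1×n}, both b R bᴴ − |b A_k|² and b₀ R b₀ᴴ − |b₀ A_k|² are nonnegative reals, and |b A_k|² · (b₀ R b₀ᴴ − |b₀ A_k|²) ≤ |b₀ A_k|² · (b R bᴴ − |b A_k|²). -/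
open Matrix
open scoped ComplexOrder

/-- Cauchy–Schwarz inequality for the sesquilinear form of a positive semidefinite matrix. -/
theorem Matrix.PosSemidef.normSq_dotProduct_mulVec_le {ι : Type*} [Fintype ι]
    {M : Matrix ι ι ℂ} (hM : M.PosSemidef) (x y : ι → ℂ) :
    Complex.normSq (star x ⬝ᵥ M *ᵥ y) ≤
      (star x ⬝ᵥ M *ᵥ x).re * (star y ⬝ᵥ M *ᵥ y).re := by
  let _ := M.toSeminormedAddCommGroup hM
  let _ := M.toInnerProductSpace hM
  have inner_eq (u v : ι → ℂ) : inner ℂ u v = star u ⬝ᵥ M *ᵥ v := dotProduct_comm _ _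
  have h := inner_mul_inner_self_le (𝕜 := ℂ) x y
  rw [norm_inner_symm y x] at h
  simpa only [inner_eq, Complex.normSq_eq_norm_sq, sq, RCLike.re_eq_complex_re] using h

/-- The power of a row through `A * Aᴴ + N` dominates its power through any column of `A`. -/
theorem sub_normSq_dotProduct_col_nonneg {ι κ : Type*} [Fintype ι] [Fintype κ]
    (A : Matrix ι κ ℂ) {N : Matrix ι ι ℂ} (hN : N.PosSemidef) (k : κ) (b : ι → ℂ) :
    0 ≤ b ⬝ᵥ (A * Aᴴ + N) *ᵥ star b - (Complex.normSq (b ⬝ᵥ Aᵀ k) : ℂ) := by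
  have hA : b ⬝ᵥ (A * Aᴴ) *ᵥ star b =
      ∑ j, (Complex.normSq (b ⬝ᵥ Aᵀ j) : ℂ) := by
    rw [← mulVec_mulVec, ← star_vecMul, dotProduct_mulVec]
    exact Finset.sum_congr rfl fun j _ => Complex.mul_conj _
  have hk : (Complex.normSq (b ⬝ᵥ Aᵀ k) : ℂ) ≤ ∑ j, (Complex.normSq (b ⬝ᵥ Aᵀ j) : ℂ) :=
    Finset.single_le_sum (f := fun j => (Complex.normSq (b ⬝ᵥ Aᵀ j) : ℂ))
      (fun j _ => Complex.zero_le_real.2 (Complex.normSq_nonneg _)) (Finset.mem_univ k)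
  have hN' : 0 ≤ b ⬝ᵥ N *ᵥ star b := by
    simpa using hN.dotProduct_mulVec_nonneg (star b)
  rw [add_mulVec, dotProduct_add, hA, add_sub_right_comm]
  exact add_nonneg (sub_nonneg.2 hk) hN'

/-- The columns of `A` lie in the range of `A * Aᴴ + N`, on which `(A * Aᴴ + N) * P` acts as the
identity for every generalized inverse `P`. -/
theorem mulVec_mulVec_col_eq {ι κ : Type*} [Fintype ι] [Fintype κ]
    (A : Matrix ι κ ℂ) {N : Matrix ι ι ℂ} (hN : N.PosSemidef) {P : Matrix ι ι ℂ}
    (hP : (A * Aᴴ + N) * P * (A * Aᴴ + N) = A * Aᴴ + N) (k : κ) :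
    (A * Aᴴ + N) *ᵥ P *ᵥ Aᵀ k = Aᵀ k := by
  classical
  set R := A * Aᴴ + N
  have hQ : (1 - R * P) * R = 0 := by rw [sub_mul, one_mul, hP, sub_self]
  have h (w : ι → ℂ) : w ⬝ᵥ (1 - R * P) *ᵥ Aᵀ k = 0 := by
    have hc := sub_normSq_dotProduct_col_nonneg A hN k (w ᵥ* (1 - R * P))
    rw [dotProduct_mulVec, vecMul_vecMul, hQ, vecMul_zero, zero_dotProduct, zero_sub,
      neg_nonneg, ← dotProduct_mulVec] at hc
    exact Complex.normSq_eq_zero.1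
      (le_antisymm (by exact_mod_cast hc) (Complex.normSq_nonneg _))
  have h0 : (1 - R * P) *ᵥ Aᵀ k = 0 := dotProduct_eq_zero _ fun w => by
    rw [dotProduct_comm, h]
  rw [sub_mulVec, one_mulVec, ← mulVec_mulVec, sub_eq_zero] at h0
  exact h0.symm

/-- SINR optimality of the row `b₀ = A_kᴴ (cov X)†`:
for `R = A Aᴴ + Σ` with `Σ` PSD and `P` a Moore–Penrose pseudoinverse of `R`,
both interference-plus-noise terms are nonnegative reals, and
`SINR_k(b₀) ≥ SINR_k(b)` in cross-multiplied form. -/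
theorem stmt0 {n m : ℕ} (A : Matrix (Fin n) (Fin m) ℂ)
    (N : Matrix (Fin n) (Fin n) ℂ) (hN : N.PosSemidef)
    (R : Matrix (Fin n) (Fin n) ℂ) (hR : R = A * Aᴴ + N)
    (P : Matrix (Fin n) (Fin n) ℂ)
    (hP1 : R * P * R = R) (hP2 : P * R * P = P)
    (hP3 : (R * P)ᴴ = R * P) (hP4 : (P * R)ᴴ = P * R)
    (k : Fin m) (b₀ : Fin n → ℂ)
    (hb₀ : b₀ = Matrix.vecMul (star (Aᵀ k)) P)
    (b : Fin n → ℂ) :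
    (∃ r : ℝ, 0 ≤ r ∧
      b ⬝ᵥ R *ᵥ star b - (Complex.normSq (b ⬝ᵥ Aᵀ k) : ℂ) = (r : ℂ)) ∧
    (∃ r : ℝ, 0 ≤ r ∧
      b₀ ⬝ᵥ R *ᵥ star b₀ - (Complex.normSq (b₀ ⬝ᵥ Aᵀ k) : ℂ) = (r : ℂ)) ∧
    (Complex.normSq (b ⬝ᵥ Aᵀ k) : ℂ) *
        (b₀ ⬝ᵥ R *ᵥ star b₀ - (Complex.normSq (b₀ ⬝ᵥ Aᵀ k) : ℂ)) ≤
      (Complex.normSq (b₀ ⬝ᵥ Aᵀ k) : ℂ) *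
        (b ⬝ᵥ R *ᵥ star b - (Complex.normSq (b ⬝ᵥ Aᵀ k) : ℂ)) := by
  have exists_real {z : ℂ} (hz : 0 ≤ z) : ∃ r : ℝ, 0 ≤ r ∧ z = (r : ℂ) := by
    obtain ⟨r, hr, rfl⟩ := RCLike.nonneg_iff_exists_ofReal.1 hz
    exact ⟨r, hr, rfl⟩
  have hpsd : R.PosSemidef := hR ▸ (posSemidef_self_mul_conjTranspose A).add hN
  have hRH : Rᴴ = R := hpsd.isHermitian
  have hnn (c : Fin n → ℂ) :
      0 ≤ c ⬝ᵥ R *ᵥ star c - (Complex.normSq (c ⬝ᵥ Aᵀ k) : ℂ) :=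
    hR ▸ sub_normSq_dotProduct_col_nonneg A hN k c
  refine ⟨exists_real (hnn b), exists_real (hnn b₀), ?_⟩
  have ha : R *ᵥ P *ᵥ Aᵀ k = Aᵀ k := by
    subst hR
    exact mulVec_mulVec_col_eq A hN hP1 k
  set a := Aᵀ k
  set y := P *ᵥ a
  have hRb₀ : R *ᵥ star b₀ = a := by
    have hRPR : R * Pᴴ * R = R := by
      simpa [conjTranspose_mul, hRH, mul_assoc] using congrArg conjTranspose hP1
    rw [hb₀, star_vecMul, star_star]
    nth_rw 1 [← ha]
    rw [mulVec_mulVec, mulVec_mulVec, hRPR, ha]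
  have hb₀a : b₀ ⬝ᵥ a = star y ⬝ᵥ R *ᵥ y := by
    rw [hb₀, ← dotProduct_mulVec, dotProduct_mulVec (star y), ← hRH, ← star_mulVec, ha]
  obtain ⟨t, ht, hty⟩ := exists_real (hpsd.dotProduct_mulVec_nonneg y)
  obtain ⟨q, -, hq⟩ := exists_real (hpsd.dotProduct_mulVec_nonneg (star b))
  have hcs := hpsd.normSq_dotProduct_mulVec_le (star b) y
  rw [hq, hty, star_star, ha, Complex.ofReal_re, Complex.ofReal_re] at hcs
  rw [star_star] at hq
  rw [hRb₀, hb₀a, hty, hq, Complex.normSq_ofReal]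
  have key : Complex.normSq (b ⬝ᵥ a) * (t - t * t) ≤
      t * t * (q - Complex.normSq (b ⬝ᵥ a)) := by
    linarith [mul_le_mul_of_nonneg_right hcs ht]
  exact_mod_cast key
end

section
/- Let A be an n×m complex matrix, let Σ be an n×n Hermitian positive semidefinite matrix, let R = A Aᴴ + Σ, and let P be a Moore–Penrose pseudoinverse of R. Fix k ∈ {1,…,m} and a nonzero complex scalar α, and let b₀ = (α A_k)ᴴ P, where A_k is the k-th column of A. Then for every row vector b ∈ ℂ^{1×n}, |b A_k|² · (b₀ R b₀ᴴ − |b₀ A_k|²) ≤ |b₀ A_k|² · (b R bᴴ − |b A_k|²). -/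
open Matrix
open scoped ComplexOrder

/-- A generalized inverse `P` of `A * Aᴴ + N` with `N` positive semidefinite satisfies
`(A * Aᴴ + N) * P * A = A`: the columns of `A` lie in the range of `A * Aᴴ + N`. -/
lemma mul_generalizedInverse_mul_self {ι κ : Type*} [Fintype ι] [DecidableEq ι] [Fintype κ]
    (A : Matrix ι κ ℂ) {N R P : Matrix ι ι ℂ} (hN : N.PosSemidef) (hR : R = A * Aᴴ + N)
    (hP : R * P * R = R) : R * P * A = A := by
  set Q : Matrix ι ι ℂ := 1 - R * P with hQ
  have hQR : Q * R = 0 := by rw [hQ, Matrix.sub_mul, Matrix.one_mul, hP, sub_self]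
  have hsum : (Q * A) * (Q * A)ᴴ + Q * N * Qᴴ = 0 := by
    rw [conjTranspose_mul, ← Matrix.mul_assoc, Matrix.mul_assoc Q A, ← Matrix.add_mul,
      ← Matrix.mul_add, ← hR, hQR, Matrix.zero_mul]
  have hQN : (Q * N * Qᴴ).PosSemidef := hN.mul_mul_conjTranspose_same Q
  have hQA : ((Q * A) * (Q * A)ᴴ).PosSemidef := posSemidef_self_mul_conjTranspose _
  have htr : ((Q * A) * (Q * A)ᴴ).trace = 0 := by
    have h := congrArg Matrix.trace hsum
    rw [Matrix.trace_add, Matrix.trace_zero] at h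
    exact ((add_eq_zero_iff_of_nonneg hQA.trace_nonneg hQN.trace_nonneg).1 h).1
  have h0 : Q * A = 0 := trace_mul_conjTranspose_self_eq_zero_iff.1 htr
  rw [hQ, Matrix.sub_mul, Matrix.one_mul, sub_eq_zero] at h0
  exact h0.symm

/-- The conjugate symmetry of the sesquilinear form of a Hermitian matrix, on row vectors. -/
lemma star_dotProduct_mulVec_star {ι : Type*} [Fintype ι] {R : Matrix ι ι ℂ}
    (hR : R.IsHermitian) (x y : ι → ℂ) :
    star (x ⬝ᵥ R *ᵥ star y) = y ⬝ᵥ R *ᵥ star x := by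
  rw [← star_dotProduct_star, star_mulVec, star_star, hR.eq, dotProduct_mulVec]

/-- The Cauchy–Schwarz inequality for a positive semidefinite matrix, multiplied by
`y ⬝ᵥ R *ᵥ star y`. -/
lemma Matrix.PosSemidef.mul_normSq_le {ι : Type*} [Fintype ι] {R : Matrix ι ι ℂ}
    (hR : R.PosSemidef) (x y : ι → ℂ) :
    (y ⬝ᵥ R *ᵥ star y) * (Complex.normSq (x ⬝ᵥ R *ᵥ star y) : ℂ) ≤
      (y ⬝ᵥ R *ᵥ star y) ^ 2 * (x ⬝ᵥ R *ᵥ star x) := by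
  have hq := star_dotProduct_mulVec_star hR.isHermitian y y
  have ht := star_dotProduct_mulVec_star hR.isHermitian x y
  rw [Complex.normSq_eq_conj_mul_self, starRingEnd_apply, ht]
  have h := hR.dotProduct_mulVec_nonneg
    (star ((y ⬝ᵥ R *ᵥ star y) • x - (x ⬝ᵥ R *ᵥ star y) • y))
  rw [star_star, star_sub, star_smul, star_smul, hq, ht] at h
  simp only [Matrix.mulVec_sub, Matrix.mulVec_smul, sub_dotProduct, dotProduct_sub,
    smul_dotProduct, dotProduct_smul, smul_eq_mul] at h
  rw [← sub_nonneg]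
  convert h using 1
  ring

/-- if `b₀ = (α A_k)ᴴ P` for a nonzero scalar `α`, where `P` is a
Moore–Penrose pseudoinverse of `R = A Aᴴ + Σ`, then `b₀` maximizes `SINR_k`
(in cross-multiplied form). -/
theorem stmt1 {n m : ℕ} (A : Matrix (Fin n) (Fin m) ℂ)
    (N : Matrix (Fin n) (Fin n) ℂ) (hN : N.PosSemidef)
    (R : Matrix (Fin n) (Fin n) ℂ) (hR : R = A * Aᴴ + N)
    (P : Matrix (Fin n) (Fin n) ℂ)
    (hP1 : R * P * R = R) (hP2 : P * R * P = P)
    (hP3 : (R * P)ᴴ = R * P) (hP4 : (P * R)ᴴ = P * R)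
    (k : Fin m) (α : ℂ) (hα : α ≠ 0) (b₀ : Fin n → ℂ)
    (hb₀ : b₀ = Matrix.vecMul (star (α • Aᵀ k)) P)
    (b : Fin n → ℂ) :
    (Complex.normSq (b ⬝ᵥ Aᵀ k) : ℂ) *
        (b₀ ⬝ᵥ R *ᵥ star b₀ - (Complex.normSq (b₀ ⬝ᵥ Aᵀ k) : ℂ)) ≤
      (Complex.normSq (b₀ ⬝ᵥ Aᵀ k) : ℂ) *
        (b ⬝ᵥ R *ᵥ star b - (Complex.normSq (b ⬝ᵥ Aᵀ k) : ℂ)) := by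
  have hRpsd : R.PosSemidef := by
    rw [hR]
    exact (posSemidef_self_mul_conjTranspose A).add hN
  have hcol : R *ᵥ (P *ᵥ Aᵀ k) = Aᵀ k := by
    rw [mulVec_mulVec]
    ext i
    exact congrFun (congrFun (mul_generalizedInverse_mul_self A hN hR hP1) i) k
  have hb₀R : b₀ ᵥ* R = star (α • Aᵀ k) := by
    conv_rhs => rw [← hcol]
    rw [hb₀]
    conv_lhs => rw [← hcol]
    rw [← mulVec_smul, star_mulVec, hRpsd.isHermitian.eq, vecMul_vecMul, vecMul_vecMul,
      ← Matrix.mul_assoc, hP1]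
  have hRb₀ : R *ᵥ star b₀ = α • Aᵀ k := by
    have h := congrArg star hb₀R
    rwa [star_vecMul, star_star, hRpsd.isHermitian.eq] at h
  have hA : Aᵀ k = α⁻¹ • R *ᵥ star b₀ := by
    rw [hRb₀, smul_smul, inv_mul_cancel₀ hα, one_smul]
  have hq : (Complex.normSq (b₀ ⬝ᵥ R *ᵥ star b₀) : ℂ) = (b₀ ⬝ᵥ R *ᵥ star b₀) ^ 2 := by
    rw [Complex.normSq_eq_conj_mul_self, starRingEnd_apply,
      star_dotProduct_mulVec_star hRpsd.isHermitian, sq]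
  have hβ : (0 : ℂ) ≤ (Complex.normSq α⁻¹ : ℂ) := by
    exact_mod_cast Complex.normSq_nonneg _
  have h := mul_le_mul_of_nonneg_left (hRpsd.mul_normSq_le b b₀) hβ
  rw [hA]
  simp only [dotProduct_smul, smul_eq_mul, Complex.normSq_mul, Complex.ofReal_mul, hq]
  rw [← sub_nonneg] at h ⊢
  convert h using 1
  ring
end

section
/- Let A be an n×m real matrix with linearly independent columns (m ≤ n), let D be an m×m real diagonal matrix with nonzero diagonal entries d₁₁,…,d_mm, let C = A D Aᵀ, and let P be a Moore–Penrose pseudoinverse of C. Then for all k, j ∈ {1,…,m} with k ≠ j, A_kᵀ P A_j = 0, and for every k, A_kᵀ P A_k = 1/d_kk, where A_k denotes the k-th column of A. -/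
open Matrix

theorem Matrix.exists_mul_eq_one_of_linearIndependent_col {K m n : Type*} [Field K] [Fintype m]
    [Fintype n] [DecidableEq m] [DecidableEq n] {A : Matrix n m K}
    (hA : LinearIndependent K A.col) : ∃ B : Matrix m n K, B * A = 1 := by
  have hker : LinearMap.ker (toLin' A) = ⊥ :=
    LinearMap.ker_eq_bot.2 (mulVec_injective_iff.2 hA)
  obtain ⟨g, hg⟩ := (toLin' A).exists_leftInverse_of_injective hker
  refine ⟨LinearMap.toMatrix' g, ?_⟩
  rw [← LinearMap.toMatrix'_toLin' A, ← LinearMap.toMatrix'_comp, hg, LinearMap.toMatrix'_id]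

/-- If the columns of `A` are linearly independent, any generalized inverse `P` of `A D Aᵀ`
satisfies `D (Aᵀ P A) D = D`. -/
theorem Matrix.mul_transpose_mul_mul_mul_of_linearIndependent_col {K m n : Type*} [Field K]
    [Fintype m] [Fintype n] {A : Matrix n m K}
    (hA : LinearIndependent K A.col) {D : Matrix m m K} {P : Matrix n n K}
    (hP : (A * D * Aᵀ) * P * (A * D * Aᵀ) = A * D * Aᵀ) :
    D * (Aᵀ * P * A) * D = D := by
  classical
  obtain ⟨B, hB⟩ := exists_mul_eq_one_of_linearIndependent_col hA
  have hBt : Aᵀ * Bᵀ = 1 := by rw [← transpose_mul, hB, transpose_one]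
  calc D * (Aᵀ * P * A) * D
      = (B * A) * D * (Aᵀ * P * A) * D * (Aᵀ * Bᵀ) := by simp [hB, hBt]
    _ = B * ((A * D * Aᵀ) * P * (A * D * Aᵀ)) * Bᵀ := by simp only [Matrix.mul_assoc]
    _ = (B * A) * D * (Aᵀ * Bᵀ) := by rw [hP]; simp only [Matrix.mul_assoc]
    _ = D := by simp [hB, hBt]

/-- pseudo-Euclidean orthogonality of the columns of `A`.
If `C = A D Aᵀ` with `D` diagonal with nonzero entries and `P` is a
Moore–Penrose pseudoinverse of `C`, then `A_kᵀ P A_j = 0` for `k ≠ j` and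
`A_kᵀ P A_k = 1 / d_kk`. -/
theorem stmt7 {n m : ℕ} (hmn : m ≤ n) (A : Matrix (Fin n) (Fin m) ℝ)
    (hA : LinearIndependent ℝ (fun j => Aᵀ j))
    (d : Fin m → ℝ) (hd : ∀ k, d k ≠ 0)
    (C P : Matrix (Fin n) (Fin n) ℝ)
    (hC : C = A * Matrix.diagonal d * Aᵀ)
    (hP1 : C * P * C = C) (hP2 : P * C * P = P)
    (hP3 : (C * P)ᵀ = C * P) (hP4 : (P * C)ᵀ = P * C) :
    (∀ k j : Fin m, k ≠ j → Aᵀ k ⬝ᵥ P *ᵥ Aᵀ j = 0) ∧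
    (∀ k : Fin m, Aᵀ k ⬝ᵥ P *ᵥ Aᵀ k = 1 / d k) := by
  subst hC
  have hD := mul_transpose_mul_mul_mul_of_linearIndependent_col hA hP1
  have hentry : ∀ k j, d k * (Aᵀ k ⬝ᵥ P *ᵥ Aᵀ j) * d j = diagonal d k j := by
    intro k j
    have hkj := congrFun₂ hD k j
    rw [mul_diagonal, diagonal_mul, Matrix.mul_assoc] at hkj
    exact hkj
  refine ⟨fun k j hkj => ?_, fun k => ?_⟩
  · simpa [hkj, hd k, hd j] using hentry k j
  · have hkk := hentry k k
    rw [diagonal_apply_eq] at hkk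
    rw [eq_div_iff (hd k)]
    exact mul_left_cancel₀ (hd k) (by rw [← mul_assoc, hkk, mul_one])
end

section
/- Let A be an n×m real matrix with linearly independent columns (m ≤ n), let D be an m×m real diagonal matrix with nonzero diagonal entries d₁₁,…,d_mm, let C = A D Aᵀ, let P be a Moore–Penrose pseudoinverse of C, and let Q be a Moore–Penrose pseudoinverse of A. Then for each k ∈ {1,…,m}, P A_k = d_kk⁻¹ · (Q_{k·})ᵀ, where A_k is the k-th column of A and Q_{k·} is the k-th row of Q. Moreover (P A_k)ᵀ A_k = d_kk⁻¹, so that P A_k / ((P A_k)ᵀ A_k) = (Q_{k·})ᵀ. -/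
open Matrix

/-- The Moore–Penrose pseudoinverse of a real matrix is unique. -/
theorem moorePenrose_unique {m n : Type*} [Fintype m] [Fintype n]
    {C : Matrix m n ℝ} {P R : Matrix n m ℝ}
    (hP1 : C * P * C = C) (hP2 : P * C * P = P)
    (hP3 : (C * P)ᵀ = C * P) (hP4 : (P * C)ᵀ = P * C)
    (hR1 : C * R * C = C) (hR2 : R * C * R = R)
    (hR3 : (C * R)ᵀ = C * R) (hR4 : (R * C)ᵀ = R * C) : P = R := by
  have hl : P * C = R * C := by
    calc P * C = (P * C)ᵀ := hP4.symm
      _ = ((P * C) * (R * C))ᵀ := by rw [Matrix.mul_assoc P, ← Matrix.mul_assoc C, hR1]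
      _ = (R * C) * (P * C) := by rw [transpose_mul, hP4, hR4]
      _ = R * C := by rw [Matrix.mul_assoc R, ← Matrix.mul_assoc C, hP1]
  have hr : C * P = C * R := by
    calc C * P = (C * P)ᵀ := hP3.symm
      _ = ((C * R) * (C * P))ᵀ := by rw [← Matrix.mul_assoc, hR1]
      _ = (C * P) * (C * R) := by rw [transpose_mul, hP3, hR3]
      _ = C * R := by rw [← Matrix.mul_assoc, hP1]
  rw [← hP2, hl, Matrix.mul_assoc, hr, ← Matrix.mul_assoc, hR2]

/-- A generalized inverse of a matrix with linearly independent columns is a left inverse. -/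
theorem mul_eq_one_of_linearIndependent_col {m n : Type*} [Fintype m] [DecidableEq m] [Fintype n]
    {A : Matrix n m ℝ} (hA : LinearIndependent ℝ A.col) {Q : Matrix m n ℝ}
    (hQ : A * Q * A = A) : Q * A = 1 := by
  have hinj := Matrix.mulVec_injective_iff.mpr hA
  refine Matrix.ext_of_mulVec_single fun i => hinj ?_
  rw [mulVec_mulVec, mulVec_mulVec, ← Matrix.mul_assoc, hQ, Matrix.mul_one]

/-- row recovery in PEGI. With `C = A D Aᵀ`, `P` a Moore–Penrose
pseudoinverse of `C` and `Q` a Moore–Penrose pseudoinverse of `A`: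
`P A_k = d_kk⁻¹ (Q_{k·})ᵀ`, `(P A_k)ᵀ A_k = d_kk⁻¹`, and hence
`P A_k / ((P A_k)ᵀ A_k) = (Q_{k·})ᵀ`. -/
theorem stmt8 {n m : ℕ} (hmn : m ≤ n) (A : Matrix (Fin n) (Fin m) ℝ)
    (hA : LinearIndependent ℝ (fun j => Aᵀ j))
    (d : Fin m → ℝ) (hd : ∀ k, d k ≠ 0)
    (C P : Matrix (Fin n) (Fin n) ℝ)
    (hC : C = A * Matrix.diagonal d * Aᵀ)
    (hP1 : C * P * C = C) (hP2 : P * C * P = P)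
    (hP3 : (C * P)ᵀ = C * P) (hP4 : (P * C)ᵀ = P * C)
    (Q : Matrix (Fin m) (Fin n) ℝ)
    (hQ1 : A * Q * A = A) (hQ2 : Q * A * Q = Q)
    (hQ3 : (A * Q)ᵀ = A * Q) (hQ4 : (Q * A)ᵀ = Q * A) :
    ∀ k : Fin m,
      P *ᵥ Aᵀ k = (d k)⁻¹ • Q k ∧
      (P *ᵥ Aᵀ k) ⬝ᵥ Aᵀ k = (d k)⁻¹ ∧
      ((P *ᵥ Aᵀ k) ⬝ᵥ Aᵀ k)⁻¹ • (P *ᵥ Aᵀ k) = Q k := by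
  have hQA : Q * A = 1 := mul_eq_one_of_linearIndependent_col hA hQ1
  have hAQt : Aᵀ * Qᵀ = 1 := by rw [← transpose_mul, hQA, transpose_one]
  have hQAt : Qᵀ * Aᵀ = A * Q := by rw [← transpose_mul, hQ3]
  have hDE : diagonal d * diagonal d⁻¹ = 1 := by
    simp [diagonal_mul_diagonal, hd]
  have hED : diagonal d⁻¹ * diagonal d = 1 := by
    simp [diagonal_mul_diagonal, hd]
  have hCR : C * (Qᵀ * diagonal d⁻¹ * Q) = A * Q := by
    calc C * (Qᵀ * diagonal d⁻¹ * Q)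
        = A * (diagonal d * (Aᵀ * Qᵀ) * diagonal d⁻¹) * Q := by
          simp only [hC, Matrix.mul_assoc]
      _ = A * Q := by rw [hAQt, Matrix.mul_one, hDE, Matrix.mul_one]
  have hRC : Qᵀ * diagonal d⁻¹ * Q * C = A * Q := by
    calc Qᵀ * diagonal d⁻¹ * Q * C
        = Qᵀ * (diagonal d⁻¹ * (Q * A) * diagonal d) * Aᵀ := by
          simp only [hC, Matrix.mul_assoc]
      _ = A * Q := by rw [hQA, Matrix.mul_one, hED, Matrix.mul_one, hQAt]
  have hP : P = Qᵀ * diagonal d⁻¹ * Q := by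
    refine moorePenrose_unique hP1 hP2 hP3 hP4 ?_ ?_ ?_ ?_
    · rw [hCR, hC, ← Matrix.mul_assoc, ← Matrix.mul_assoc, hQ1]
    · rw [Matrix.mul_assoc, hCR, Matrix.mul_assoc, ← Matrix.mul_assoc Q, hQ2]
    · rw [hCR, hQ3]
    · rw [hRC, hQ3]
  have hPA : P * A = Qᵀ * diagonal d⁻¹ := by
    rw [hP, Matrix.mul_assoc, hQA, Matrix.mul_one]
  intro k
  have hcol : P *ᵥ Aᵀ k = (d k)⁻¹ • Q k := by
    ext i
    have h := congrFun (congrFun hPA i) k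
    rw [mul_diagonal, transpose_apply, mul_comm] at h
    exact h
  have hdot : Q k ⬝ᵥ Aᵀ k = 1 := by
    have h := congrFun (congrFun hQA k) k
    rwa [one_apply_eq] at h
  have hscal : (P *ᵥ Aᵀ k) ⬝ᵥ Aᵀ k = (d k)⁻¹ := by
    rw [hcol, smul_dotProduct, hdot, smul_eq_mul, mul_one]
  refine ⟨hcol, hscal, ?_⟩
  rw [hscal, hcol, smul_smul, inv_inv, mul_inv_cancel₀ (hd k), one_smul]
end

section
/- Let A be an n×m real matrix with linearly independent columns (m ≤ n), let D be an m×m real diagonal matrix with nonzero diagonal entries d₁₁,…,d_mm, let C = A D Aᵀ, let P be a Moore–Penrose pseudoinverse of C, and let Q be a Moore–Penrose pseudoinverse of A. Then for any real scalars c₁,…,c_m and every u ∈ ℝⁿ, one has Σ_{k=1}^m c_k (A_kᵀ P u)³ A_k = Σ_{k=1}^m c_k d_kk⁻³ ((Q u)_k)³ A_k, where A_k denotes the k-th column of A and (Q u)_k the k-th coordinate of Q u. -/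
open Matrix

/-- An inner inverse of a matrix with linearly independent columns is a left inverse. -/
theorem Matrix.mul_eq_one_of_mul_mul_eq_self {ι κ K : Type*} [Fintype ι] [Fintype κ]
    [DecidableEq κ] [Field K] {A : Matrix ι κ K} (hA : LinearIndependent K (fun j => Aᵀ j))
    {Q : Matrix κ ι K} (hQ : A * Q * A = A) : Q * A = 1 := by
  have hinj : Function.Injective A.mulVec := Matrix.mulVec_injective_iff.2 hA
  apply Matrix.mulVec_injective
  funext v
  apply hinj
  simp only [Matrix.mulVec_mulVec, ← Matrix.mul_assoc, hQ, Matrix.mul_one]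

/-- If `P` is an inner inverse of `A D Aᵀ` with `A D Aᵀ P` symmetric, and `Q` is a left inverse of
`A` with `A Q` symmetric, then `Aᵀ P = D⁻¹ Q`. -/
theorem Matrix.transpose_mul_eq_of_mul_mul_transpose {ι κ K : Type*} [Fintype ι] [Fintype κ]
    [DecidableEq κ] [Field K] {A : Matrix ι κ K} {D E : Matrix κ κ K} (hED : E * D = 1)
    {P : Matrix ι ι K} (hP : A * D * Aᵀ * P * (A * D * Aᵀ) = A * D * Aᵀ)
    (hPs : (A * D * Aᵀ * P)ᵀ = A * D * Aᵀ * P)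
    {Q : Matrix κ ι K} (hQA : Q * A = 1) (hQs : (A * Q)ᵀ = A * Q) :
    Aᵀ * P = E * Q := by
  have hDE : D * E = 1 := mul_eq_one_comm.1 hED
  have hAQ : Aᵀ * Qᵀ = 1 := by rw [← Matrix.transpose_mul, hQA, Matrix.transpose_one]
  have hEQ : E * Q * (A * D) = 1 := by
    rw [Matrix.mul_assoc, ← Matrix.mul_assoc Q, hQA, Matrix.one_mul, hED]
  have hproj : Aᵀ * (A * Q) = Aᵀ := by
    rw [← hQs, ← Matrix.transpose_mul, Matrix.mul_assoc, hQA, Matrix.mul_one]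
  have hPA : Aᵀ * P * A = E := by
    calc Aᵀ * P * A
        = (E * Q * (A * D)) * (Aᵀ * P * A) * (D * (Aᵀ * Qᵀ) * E) := by
          rw [hEQ, hAQ, Matrix.one_mul, Matrix.mul_one, hDE, Matrix.mul_one]
      _ = E * Q * (A * D * Aᵀ * P * (A * D * Aᵀ)) * (Qᵀ * E) := by
          simp only [Matrix.mul_assoc]
      _ = (E * Q * (A * D)) * (Aᵀ * Qᵀ) * E := by
          rw [hP]; simp only [Matrix.mul_assoc]
      _ = E := by rw [hEQ, hAQ, Matrix.one_mul, Matrix.one_mul]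
  have hrow : Aᵀ * P = E * Q * (Pᵀ * A * Dᵀ) * Aᵀ := by
    calc Aᵀ * P = E * Q * (A * D) * (Aᵀ * P) := by rw [hEQ, Matrix.one_mul]
      _ = E * Q * (A * D * Aᵀ * P) := by simp only [Matrix.mul_assoc]
      _ = E * Q * (Pᵀ * A * Dᵀ) * Aᵀ := by
          rw [← hPs]
          simp only [Matrix.transpose_mul, Matrix.transpose_transpose, Matrix.mul_assoc]
  calc Aᵀ * P = Aᵀ * P * (A * Q) := by rw [hrow, Matrix.mul_assoc _ Aᵀ, hproj]
    _ = E * Q := by rw [← Matrix.mul_assoc, hPA]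

/-- the PEGI update is a power iteration in the hidden coordinate
system: `Σ_k c_k (A_kᵀ P u)³ A_k = Σ_k c_k d_kk⁻³ ((Q u)_k)³ A_k` where `P` is
a Moore–Penrose pseudoinverse of `C = A D Aᵀ` and `Q` one of `A`. -/
theorem stmt9 {n m : ℕ} (hmn : m ≤ n) (A : Matrix (Fin n) (Fin m) ℝ)
    (hA : LinearIndependent ℝ (fun j => Aᵀ j))
    (d : Fin m → ℝ) (hd : ∀ k, d k ≠ 0)
    (C P : Matrix (Fin n) (Fin n) ℝ)
    (hC : C = A * Matrix.diagonal d * Aᵀ)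
    (hP1 : C * P * C = C) (hP2 : P * C * P = P)
    (hP3 : (C * P)ᵀ = C * P) (hP4 : (P * C)ᵀ = P * C)
    (Q : Matrix (Fin m) (Fin n) ℝ)
    (hQ1 : A * Q * A = A) (hQ2 : Q * A * Q = Q)
    (hQ3 : (A * Q)ᵀ = A * Q) (hQ4 : (Q * A)ᵀ = Q * A)
    (c : Fin m → ℝ) (u : Fin n → ℝ) :
    ∑ k : Fin m, (c k * (Aᵀ k ⬝ᵥ P *ᵥ u) ^ 3) • Aᵀ k =
      ∑ k : Fin m, (c k * ((d k)⁻¹) ^ 3 * ((Q *ᵥ u) k) ^ 3) • Aᵀ k := by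
  subst hC
  have hED : Matrix.diagonal (fun k => (d k)⁻¹) * Matrix.diagonal d = 1 := by
    rw [Matrix.diagonal_mul_diagonal, ← Matrix.diagonal_one]
    congr 1
    funext k
    exact inv_mul_cancel₀ (hd k)
  have key := Matrix.transpose_mul_eq_of_mul_mul_transpose hED hP1 hP3
    (Matrix.mul_eq_one_of_mul_mul_eq_self hA hQ1) hQ3
  refine Finset.sum_congr rfl fun k _ => ?_
  have hk : Aᵀ k ⬝ᵥ P *ᵥ u = (d k)⁻¹ * (Q *ᵥ u) k := by
    change (Aᵀ *ᵥ (P *ᵥ u)) k = _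
    rw [Matrix.mulVec_mulVec, key, ← Matrix.mulVec_mulVec, Matrix.mulVec_diagonal]
  rw [hk, mul_pow, mul_assoc]
end
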